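/- arXiv:2001.08117 — 2 statements merged into one kernel-verified Lean document; each statement's English description precedes it below -/
import Mathlib

section
/- Let p be a prime, s ∈ ℤ_{≥1}, a ∈ ℤ_p ∖ ℤ_{≤0}, and c ∈ 1+qW. Then the function k ↦ B_k/A_k on ℤ_{≥0} is Lipschitz; that is, B_k/A_k ∈ W for every k (note A_k ≠ 0 since a ∉ ℤ_{≤0}), and for all k, k′, m ∈ ℤ_{≥0}, p^m | (k − k′) implies B_k/A_k − B_{k′}/A_{k′} ∈ p^m W. -/
open scoped Classical

namespace HGP

/-- `𝔽̄_p`, an algebraic closure of the prime field `𝔽_p`. -/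
abbrev Fbar (p : ℕ) [Fact p.Prime] : Type _ := AlgebraicClosure (ZMod p)

/-- `W = W(𝔽̄_p)`, the ring of Witt vectors of `𝔽̄_p`. -/
abbrev Wp (p : ℕ) [Fact p.Prime] : Type _ := WittVector p (Fbar p)

/-- `K = Frac W`. -/
abbrev Kp (p : ℕ) [Fact p.Prime] : Type _ := FractionRing (Wp p)

/-- The canonical embedding `ℤ_p = W(𝔽_p) → W(𝔽̄_p)`. -/
noncomputable def iota (p : ℕ) [Fact p.Prime] : ℤ_[p] →+* Wp p :=
  (WittVector.map (algebraMap (ZMod p) (Fbar p))).comp (WittVector.equiv p).symm.toRingHom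

/-- The canonical embedding `W → K`. -/
noncomputable def iotaK (p : ℕ) [Fact p.Prime] : Wp p →+* Kp p := algebraMap (Wp p) (Kp p)

/-- `l`: the unique integer in `{0,…,p−1}` with `a + l ≡ 0 mod p`. -/
noncomputable def dl (p : ℕ) [Fact p.Prime] (a : ℤ_[p]) : ℕ := (-a).appr 1

/-- `q := 4` if `p = 2` and `q := p` otherwise. -/
def qq (p : ℕ) : ℕ := if p = 2 then 4 else p

/-- `l′`: the unique integer in `{0,…,q−1}` with `a + l′ ≡ 0 mod q`. -/
noncomputable def dl' (p : ℕ) [Fact p.Prime] (a : ℤ_[p]) : ℕ :=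
  (-a).appr (if p = 2 then 2 else 1)

/-- `e := l′ − ⌊l′/p⌋`. -/
noncomputable def de (p : ℕ) [Fact p.Prime] (a : ℤ_[p]) : ℕ := dl' p a - dl' p a / p

/-- `a ∈ ℤ_p ∖ ℤ_{≤0}`, i.e. `a` is not a nonpositive rational integer. -/
def NotNonposInt (p : ℕ) [Fact p.Prime] (a : ℤ_[p]) : Prop := ∀ n : ℕ, a + (n : ℤ_[p]) ≠ 0

/-- `a′` is the Dwork prime of `a`, i.e. `p·a′ = a + l`. -/
def IsDworkPrime (p : ℕ) [Fact p.Prime] (a a' : ℤ_[p]) : Prop :=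
  (p : ℤ_[p]) * a' = a + (dl p a : ℤ_[p])

/-- `A k = ((a)_k / k!)^s ∈ ℤ_p`, characterized by `k!^s · A k = ((a)_k)^s`. -/
def IsHGCoeff (p : ℕ) [Fact p.Prime] (s : ℕ) (a : ℤ_[p]) (A : ℕ → ℤ_[p]) : Prop :=
  ∀ k : ℕ, (k.factorial : ℤ_[p]) ^ s * A k = ((ascPochhammer ℤ_[p] k).eval a) ^ s

/-- `f = (α ↦ c^α)` for `c ∈ 1 + pW`: `c^α` is uniquely characterized by
`c^α ≡ c^{α_n} mod p^n W` for any natural approximation `α_n` of `α` mod `p^n`. -/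
def IsCpow (p : ℕ) [Fact p.Prime] (c : Wp p) (f : ℤ_[p] → Wp p) : Prop :=
  ∀ (α : ℤ_[p]) (n : ℕ), f α - c ^ (α.appr n) ∈ Ideal.span {(p : Wp p) ^ n}

/-- The coefficients `B_k` of `Ĝ^{(σ)}_{a,…,a}(t)`, as elements of `K = Frac W`:
`B_k = (k+a)⁻¹ (A_k − (−1)^{se} A^{(1)}_{(k−l)/p} c^{(k−l)/p + a′})`. -/
noncomputable def BhatK (p : ℕ) [Fact p.Prime] (s : ℕ) (a a' : ℤ_[p]) (A A1 : ℕ → ℤ_[p])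
    (cpw : ℤ_[p] → Wp p) (k : ℕ) : Kp p :=
  ((k : Kp p) + iotaK p (iota p a))⁻¹ *
    (iotaK p (iota p (A k)) -
      (if dl p a ≤ k ∧ p ∣ (k - dl p a) then
        (-1 : Kp p) ^ (s * de p a) * iotaK p (iota p (A1 ((k - dl p a) / p))) *
          iotaK p (cpw ((((k - dl p a) / p : ℕ) : ℤ_[p]) + a'))
      else 0))

/-- `B : ℕ → W` is the coefficient function of `Ĝ^{(σ)}_{a,…,a}(t)`, characterized in `W` by
`(k+a)·B_k = A_k − (−1)^{se} A^{(1)}_{(k−l)/p} c^{(k−l)/p + a′}`. -/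
def IsBhat (p : ℕ) [Fact p.Prime] (s : ℕ) (a a' : ℤ_[p]) (A A1 : ℕ → ℤ_[p])
    (cpw : ℤ_[p] → Wp p) (B : ℕ → Wp p) : Prop :=
  ∀ k : ℕ, ((k : Wp p) + iota p a) * B k =
    iota p (A k) -
      (if dl p a ≤ k ∧ p ∣ (k - dl p a) then
        (-1 : Wp p) ^ (s * de p a) * iota p (A1 ((k - dl p a) / p)) *
          cpw ((((k - dl p a) / p : ℕ) : ℤ_[p]) + a')
      else 0)

/-- A function `ℕ → K` is Lipschitz: it takes values in `W` and
`p^m ∣ (n − n′)` implies `f n − f n′ ∈ p^m W`. -/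
def LipschitzSeq (p : ℕ) [Fact p.Prime] (f : ℕ → Kp p) : Prop :=
  (∀ n : ℕ, f n ∈ (iotaK p).range) ∧
    ∀ n n' m : ℕ, ((p : ℤ) ^ m ∣ (n : ℤ) - (n' : ℤ)) →
      ∃ w : Wp p, f n - f n' = (p : Kp p) ^ m * iotaK p w

/-- `L` is the `p`-adic limit of the sequence `s` in `W`. -/
def WLim (p : ℕ) [Fact p.Prime] (s : ℕ → Wp p) (L : Wp p) : Prop :=
  ∀ m : ℕ, ∃ M : ℕ, ∀ n ≥ M, L - s n ∈ Ideal.span {(p : Wp p) ^ m}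

/-- `{α}_k := Π_{1 ≤ i ≤ k, p ∤ (α+i−1)} (α+i−1)`. -/
noncomputable def curly (p : ℕ) [Fact p.Prime] (α : ℤ_[p]) (k : ℕ) : ℤ_[p] :=
  ∏ j ∈ Finset.range k, if (p : ℤ_[p]) ∣ (α + (j : ℤ_[p])) then 1 else (α + (j : ℤ_[p]))

/-- `W/p^n W`. -/
abbrev Qn (p : ℕ) [Fact p.Prime] (n : ℕ) := Wp p ⧸ Ideal.span {(p : Wp p) ^ n}

/-- Laurent polynomials over `W/p^n`, obtained from polynomials over `W`. -/
noncomputable def laurentOfPolyW (p : ℕ) [Fact p.Prime] (n : ℕ) :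
    Polynomial (Wp p) →+* LaurentPolynomial (Qn p n) :=
  (Polynomial.toLaurent).comp
    (Polynomial.mapRingHom (Ideal.Quotient.mk (Ideal.span {(p : Wp p) ^ n})))

/-- `R_n := (W/p^n)[t,t⁻¹, h(t)⁻¹]`, the localization of the Laurent polynomial ring
over `W/p^n` away from (the image of) `h`. -/
abbrev Rn (p : ℕ) [Fact p.Prime] (h : Polynomial (Wp p)) (n : ℕ) :=
  Localization.Away (laurentOfPolyW p n h)

/-- The canonical map from Laurent polynomials over `W/p^n` to `R_n`. -/
noncomputable def mkRn (p : ℕ) [Fact p.Prime] (h : Polynomial (Wp p)) (n : ℕ) :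
    LaurentPolynomial (Qn p n) →+* Rn p h n := algebraMap _ _

/-- The canonical map from polynomials over `W` to `R_n`. -/
noncomputable def toRn (p : ℕ) [Fact p.Prime] (h : Polynomial (Wp p)) (n : ℕ) :
    Polynomial (Wp p) →+* Rn p h n := (mkRn p h n).comp (laurentOfPolyW p n)


/-! ### Helper material -/

/-- Both elements are, modulo `P`, of the form `1 - z g` with `g` varying in a Lipschitz way. -/
def Apx {R : Type*} [CommRing R] (P z z' x x' : R) : Prop :=
  ∃ g g' : R, P ∣ x - (1 - z * g) ∧ P ∣ x' - (1 - z' * g') ∧ (z - z') ∣ g - g'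

theorem Apx.one {R : Type*} [CommRing R] (P z z' : R) : Apx P z z' 1 1 :=
  ⟨0, 0, by simp, by simp, by simp⟩

theorem Apx.lin {R : Type*} [CommRing R] (P z z' v : R) : Apx P z z' (1 + z * v) (1 + z' * v) :=
  ⟨-v, -v, by simp, by simp, by simp⟩

theorem Apx.mul {R : Type*} [CommRing R] {P z z' x x' y y' : R} (hx : Apx P z z' x x')
    (hy : Apx P z z' y y') : Apx P z z' (x * y) (x' * y') := by
  obtain ⟨g, g', ⟨t, ht⟩, ⟨t', ht'⟩, ⟨d, hd⟩⟩ := hx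
  obtain ⟨h, h', ⟨r, hr⟩, ⟨r', hr'⟩, ⟨e, he⟩⟩ := hy
  refine ⟨g + h - z * g * h, g' + h' - z' * g' * h', ⟨t * y + (1 - z * g) * r, ?_⟩,
    ⟨t' * y' + (1 - z' * g') * r', ?_⟩, ⟨d + e - g * h - z' * d * h - z' * g' * e, ?_⟩⟩
  · linear_combination y * ht + (1 - z * g) * hr
  · linear_combination y' * ht' + (1 - z' * g') * hr'
  · linear_combination (1 - z' * h) * hd + (1 - z' * g') * he

theorem Apx.pow {R : Type*} [CommRing R] {P z z' x x' : R} (hx : Apx P z z' x x') (s : ℕ) :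
    Apx P z z' (x ^ s) (x' ^ s) := by
  induction s with
  | zero => simpa using Apx.one P z z'
  | succ n ih => rw [pow_succ, pow_succ]; exact ih.mul hx

theorem Apx.prod {R : Type*} [CommRing R] {P z z' : R} (v : ℕ → R) (n : ℕ) :
    Apx P z z' (∏ i ∈ Finset.range n, (1 + z * v i)) (∏ i ∈ Finset.range n, (1 + z' * v i)) := by
  induction n with
  | zero => simpa using Apx.one P z z'
  | succ n ih =>
    rw [Finset.prod_range_succ, Finset.prod_range_succ]; exact ih.mul (Apx.lin _ _ _ _)

theorem Apx.congr {R : Type*} [CommRing R] {P z z' x x' y y' : R} (hx : Apx P z z' x x')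
    (h : P ∣ y - x) (h' : P ∣ y' - x') : Apx P z z' y y' := by
  obtain ⟨g, g', h1, h2, h3⟩ := hx
  refine ⟨g, g', ?_, ?_, h3⟩
  · have := dvd_add h h1; simpa using this
  · have := dvd_add h' h2; simpa using this

theorem Apx.map {R S : Type*} [CommRing R] [CommRing S] (f : R →+* S) {P z z' x x' : R}
    (hx : Apx P z z' x x') : Apx (f P) (f z) (f z') (f x) (f x') := by
  obtain ⟨g, g', h1, h2, h3⟩ := hx
  refine ⟨f g, f g', ?_, ?_, ?_⟩
  · simpa using map_dvd f h1
  · simpa using map_dvd f h2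
  · simpa using map_dvd f h3

theorem Apx.final {R : Type*} [CommRing R] (p z z' x x' : R) (M0 m : ℕ)
    (hz : z ∣ p ^ M0) (hz' : z' ∣ p ^ M0) (hm : p ^ m ∣ z - z')
    (h : ∀ M, 2 ≤ M → Apx (p ^ M) z z' x x') :
    ∃ F F' : R, 1 - x = z * F ∧ 1 - x' = z' * F' ∧ p ^ m ∣ F - F' := by
  obtain ⟨g, g', ⟨t, ht⟩, ⟨t', ht'⟩, h3⟩ := h (M0 + m + 2) (by omega)
  obtain ⟨y, hy⟩ := hz
  obtain ⟨y', hy'⟩ := hz'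
  obtain ⟨d, hd⟩ := hm.trans h3
  refine ⟨g - p ^ (m + 2) * y * t, g' - p ^ (m + 2) * y' * t', ?_, ?_,
    ⟨d - p ^ 2 * y * t + p ^ 2 * y' * t', ?_⟩⟩
  · rw [show M0 + m + 2 = M0 + (m + 2) by ring, pow_add, hy] at ht
    linear_combination -ht
  · rw [show M0 + m + 2 = M0 + (m + 2) by ring, pow_add, hy'] at ht'
    linear_combination -ht'
  · linear_combination hd

/-- `U x = x` for `x` prime to `p`, and `1` otherwise. -/
noncomputable def U (p : ℕ) [Fact p.Prime] (x : ℤ_[p]) : ℤ_[p] :=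
  if (p : ℤ_[p]) ∣ x then 1 else x

/-- The complementary factor: `V x = x` for `p ∣ x`, and `1` otherwise. -/
noncomputable def V (p : ℕ) [Fact p.Prime] (x : ℤ_[p]) : ℤ_[p] :=
  if (p : ℤ_[p]) ∣ x then x else 1

/-- `{α}_k`. -/
noncomputable def cu (p : ℕ) [Fact p.Prime] (α : ℤ_[p]) (k : ℕ) : ℤ_[p] :=
  ∏ j ∈ Finset.range k, U p (α + (j : ℤ_[p]))

theorem U_mul_V (p : ℕ) [Fact p.Prime] (x : ℤ_[p]) : U p x * V p x = x := by
  unfold U V; split_ifs <;> simp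

theorem isUnit_of_not_dvd (p : ℕ) [Fact p.Prime] (x : ℤ_[p]) (h : ¬ (p : ℤ_[p]) ∣ x) :
    IsUnit x := by
  by_contra hx
  exact h ((PadicInt.norm_lt_one_iff_dvd x).1 (PadicInt.not_isUnit_iff.1 hx))

theorem isUnit_U (p : ℕ) [Fact p.Prime] (x : ℤ_[p]) : IsUnit (U p x) := by
  unfold U; split_ifs with h
  · exact isUnit_one
  · exact isUnit_of_not_dvd p x h

theorem isUnit_cu (p : ℕ) [Fact p.Prime] (x : ℤ_[p]) (k : ℕ) : IsUnit (cu p x k) := by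
  unfold cu
  induction k with
  | zero => simp
  | succ n ih => rw [Finset.prod_range_succ]; exact ih.mul (isUnit_U _ _)

theorem U_zero (p : ℕ) [Fact p.Prime] : U p 0 = 1 := by simp [U]

theorem cu_add (p : ℕ) [Fact p.Prime] (α : ℤ_[p]) (k m : ℕ) :
    cu p α (k + m) = cu p α k * cu p (α + k) m := by
  unfold cu
  rw [Finset.prod_range_add]
  congr 1
  apply Finset.prod_congr rfl
  intro i _
  push_cast
  rw [add_assoc]

theorem cu_one (p : ℕ) [Fact p.Prime] (α : ℤ_[p]) : cu p α 1 = U p α := by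
  simp [cu]

theorem cu_zero_succ (p : ℕ) [Fact p.Prime] (k : ℕ) : cu p 0 (k + 1) = cu p 1 k := by
  rw [add_comm, cu_add, cu_one, U_zero]; simp

theorem p_not_unit (p : ℕ) [Fact p.Prime] : ¬ IsUnit (p : ℤ_[p]) := PadicInt.prime_p.not_isUnit

theorem natCast_dvd_iff (p : ℕ) [Fact p.Prime] (n : ℕ) : (p : ℤ_[p]) ∣ (n : ℤ_[p]) ↔ p ∣ n := by
  have := PadicInt.norm_int_lt_one_iff_dvd (p := p) (n : ℤ)
  rw [← PadicInt.norm_lt_one_iff_dvd]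
  push_cast at this
  rw [this]
  exact Int.natCast_dvd_natCast

theorem cu_congr (p : ℕ) [Fact p.Prime] (α β : ℤ_[p]) (k M : ℕ) (hM : 1 ≤ M)
    (h : (p : ℤ_[p]) ^ M ∣ α - β) : (p : ℤ_[p]) ^ M ∣ cu p α k - cu p β k := by
  induction k with
  | zero => simp [cu]
  | succ n ih =>
    have hU : (p : ℤ_[p]) ^ M ∣ U p (α + n) - U p (β + n) := by
      have h1 : (p : ℤ_[p]) ∣ α - β := (dvd_pow_self _ (by omega)).trans h
      have h2 : (p : ℤ_[p]) ∣ α + n ↔ (p : ℤ_[p]) ∣ β + n := by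
        rw [show α + (n : ℤ_[p]) = (α - β) + (β + n) by ring]
        exact dvd_add_right h1
      unfold U
      by_cases h3 : (p : ℤ_[p]) ∣ β + n
      · rw [if_pos h3, if_pos (h2.2 h3)]; simp
      · rw [if_neg h3, if_neg (fun h4 => h3 (h2.1 h4))]; simpa using h
    obtain ⟨x, hx⟩ := ih
    obtain ⟨y, hy⟩ := hU
    rw [cu_add, cu_add, cu_one, cu_one]
    exact ⟨x * U p (α + n) + cu p β n * y, by
      linear_combination U p (α + n) * hx + cu p β n * hy⟩

theorem U_neg (p : ℕ) [Fact p.Prime] (n : ℕ) :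
    U p (-(n : ℤ_[p])) = (if p ∣ n then 1 else -1) * U p n := by
  unfold U
  simp only [dvd_neg, natCast_dvd_iff]
  split_ifs <;> simp

theorem cu_neg_self (p : ℕ) [Fact p.Prime] (r : ℕ) :
    cu p (-(r : ℤ_[p])) r = (-1) ^ (r - r / p) * cu p 1 r := by
  induction r with
  | zero => simp [cu]
  | succ n ih =>
    have e1 : cu p (-((n + 1 : ℕ) : ℤ_[p])) (n + 1) =
        U p (-((n + 1 : ℕ) : ℤ_[p])) * cu p (-(n : ℤ_[p])) n := by
      rw [add_comm n 1, cu_add, cu_one]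
      congr 2
      push_cast; ring
    rw [e1, ih, cu_add, cu_one, U_neg, Nat.succ_div]
    have h1 : n / p ≤ n := Nat.div_le_self _ _
    have e2 : (1 : ℤ_[p]) + n = ((n + 1 : ℕ) : ℤ_[p]) := by push_cast; ring
    rw [e2]
    split_ifs with h
    · rw [show n + 1 - (n / p + 1) = n - n / p by omega]; ring
    · rw [show n + 1 - (n / p + 0) = n - n / p + 1 by omega, pow_succ]; ring

theorem cu_key (p : ℕ) [Fact p.Prime] (k r : ℕ) :
    cu p (-(r : ℤ_[p])) k * cu p (k - r : ℤ_[p]) (r + 1) =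
      (-1) ^ (r - r / p) * cu p 1 r * cu p 1 k := by
  have h1 : cu p (-(r : ℤ_[p])) (k + (r + 1)) = _ := cu_add _ _ _ _
  have h2 : cu p (-(r : ℤ_[p])) (r + (k + 1)) = _ := cu_add _ _ _ _
  rw [show k + (r + 1) = r + (k + 1) by ring, h2, neg_add_cancel, cu_zero_succ, cu_neg_self,
    show -(r : ℤ_[p]) + k = k - r by ring] at h1
  rw [← h1]

/-- Inverse of `i` if it is prime to `p`, and `0` otherwise. -/
noncomputable def vinv (p : ℕ) [Fact p.Prime] (i : ℕ) : ℤ_[p] :=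
  if (p : ℤ_[p]) ∣ i then 0 else Ring.inverse (i : ℤ_[p])

theorem U_vinv (p : ℕ) [Fact p.Prime] (z : ℤ_[p]) (hz : (p : ℤ_[p]) ∣ z) (i : ℕ) :
    U p (z + i) = U p (0 + i) * (1 + z * vinv p i) := by
  unfold U vinv
  simp only [dvd_add_right hz, zero_add]
  split_ifs with h
  · simp
  · have := Ring.mul_inverse_cancel _ (isUnit_of_not_dvd p _ h)
    linear_combination (-z) * this

theorem cu_vinv (p : ℕ) [Fact p.Prime] (z : ℤ_[p]) (hz : (p : ℤ_[p]) ∣ z) (r : ℕ) :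
    cu p z (r + 1) = cu p 1 r * ∏ i ∈ Finset.range (r + 1), (1 + z * vinv p i) := by
  rw [← cu_zero_succ]
  unfold cu
  rw [← Finset.prod_mul_distrib]
  exact Finset.prod_congr rfl fun i _ => U_vinv p z hz i

theorem prod_congr_lin (p : ℕ) [Fact p.Prime] (P z z' : ℤ_[p]) (h : P ∣ z - z') (n : ℕ) :
    P ∣ ∏ i ∈ Finset.range n, (1 + z * vinv p i) - ∏ i ∈ Finset.range n, (1 + z' * vinv p i) := by
  induction n with
  | zero => simp
  | succ n ih =>
    rw [Finset.prod_range_succ, Finset.prod_range_succ]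
    obtain ⟨x, hx⟩ := ih
    obtain ⟨y, hy⟩ := h
    exact ⟨x * (1 + z * vinv p n) + (∏ i ∈ Finset.range n, (1 + z' * vinv p i)) * y * vinv p n, by
      linear_combination (1 + z * vinv p n) * hx +
        (∏ i ∈ Finset.range n, (1 + z' * vinv p i)) * vinv p n * hy⟩

theorem sign_eq (p : ℕ) [hp : Fact p.Prime] (a : ℤ_[p]) (M : ℕ) (hM : 2 ≤ M) :
    (-1 : ℤ_[p]) ^ ((-a).appr M - (-a).appr M / p) = (-1) ^ (de p a) := by
  have hpos := hp.out.pos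
  unfold de dl'
  set j := if p = 2 then 2 else 1 with hj
  have hjM : j ≤ M := by rw [hj]; split_ifs <;> omega
  obtain ⟨t, ht⟩ := PadicInt.dvd_appr_sub_appr (-a) j M hjM
  have hle := PadicInt.appr_mono (-a) hjM
  have hr : (-a).appr M = (-a).appr j + p ^ j * t := by omega
  generalize (-a).appr M = r at *
  generalize (-a).appr j = l at *
  obtain ⟨j', hj'⟩ : ∃ j', j = j' + 1 := ⟨j - 1, by rw [hj]; split_ifs <;> rfl⟩
  have hdiv : r / p = l / p + p ^ j' * t := by
    rw [hr, hj', pow_succ, show l + p ^ j' * p * t = l + p * (p ^ j' * t) by ring,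
      Nat.add_mul_div_left _ _ hpos]
  have heven : Even (p ^ j' * (p - 1)) := by
    rcases hp.out.eq_two_or_odd' with h2 | hodd
    · have : j' = 1 := by rw [if_pos h2] at hj; omega
      rw [this, h2]; decide
    · exact (Nat.Odd.sub_odd hodd odd_one).mul_left _
  have hl : l / p ≤ l := Nat.div_le_self _ _
  have key : r - r / p = (l - l / p) + p ^ j' * (p - 1) * t := by
    rw [hdiv, hr, hj', pow_succ]
    have h1 : p ^ j' * (p - 1 + 1) * t = p ^ j' * (p - 1) * t + p ^ j' * t := by ring
    rw [Nat.sub_add_cancel hpos] at h1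
    omega
  rw [key, pow_add, (heven.mul_right t).neg_one_pow, mul_one]

/-- The unit `(-1)^e {1}_k / {a}_k`. -/
noncomputable def hh (p : ℕ) [Fact p.Prime] (a : ℤ_[p]) (k : ℕ) : ℤ_[p] :=
  (-1) ^ (de p a) * cu p 1 k * Ring.inverse (cu p a k)

theorem hh_spec (p : ℕ) [Fact p.Prime] (a : ℤ_[p]) (k : ℕ) :
    hh p a k * cu p a k = (-1) ^ (de p a) * cu p 1 k := by
  unfold hh
  rw [mul_assoc, Ring.inverse_mul_cancel _ (isUnit_cu p a k), mul_one]

theorem hh_approx (p : ℕ) [Fact p.Prime] (a : ℤ_[p]) (k M : ℕ) (hM : 2 ≤ M)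
    (hk : (p : ℤ_[p]) ∣ k + a) :
    (p : ℤ_[p]) ^ M ∣ hh p a k -
      ∏ i ∈ Finset.range ((-a).appr M + 1), (1 + (k + a) * vinv p i) := by
  have hs := sign_eq p a M hM
  have hr := Ideal.mem_span_singleton.1 (PadicInt.appr_spec M (-a))
  generalize (-a).appr M = r at *
  have hpM : (p : ℤ_[p]) ∣ (p : ℤ_[p]) ^ M := dvd_pow_self _ (by omega)
  have hz : (p : ℤ_[p]) ^ M ∣ (k - r : ℤ_[p]) - (k + a) := by
    rwa [show (k - r : ℤ_[p]) - (k + a) = -a - r by ring]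
  have hkr : (p : ℤ_[p]) ∣ (k - r : ℤ_[p]) := by
    have := dvd_add (hpM.trans hz) hk
    rwa [sub_add_cancel] at this
  have key := cu_key p k r
  rw [cu_vinv p _ hkr, hs] at key
  have key2 : cu p (-(r : ℤ_[p])) k *
      ∏ i ∈ Finset.range (r + 1), (1 + (k - r : ℤ_[p]) * vinv p i) =
      (-1) ^ (de p a) * cu p 1 k := by
    apply (isUnit_cu p 1 r).mul_left_cancel
    linear_combination key
  rw [← hh_spec] at key2
  obtain ⟨x, hx⟩ := cu_congr p (-(r : ℤ_[p])) a k M (by omega)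
    (by rwa [show (-(r : ℤ_[p]) - a) = -a - r by ring])
  obtain ⟨y, hy⟩ := prod_congr_lin p _ _ _ hz (r + 1)
  rw [← (isUnit_cu p a k).dvd_mul_right]
  refine ⟨x * ∏ i ∈ Finset.range (r + 1), (1 + (k - r : ℤ_[p]) * vinv p i) + cu p a k * y, ?_⟩
  linear_combination (-1 : ℤ_[p]) * key2 +
    (∏ i ∈ Finset.range (r + 1), (1 + (k - r : ℤ_[p]) * vinv p i)) * hx + cu p a k * hy

theorem hh_Apx (p : ℕ) [Fact p.Prime] (a : ℤ_[p]) (k k' M : ℕ) (hM : 2 ≤ M)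
    (hk : (p : ℤ_[p]) ∣ k + a) (hk' : (p : ℤ_[p]) ∣ k' + a) :
    Apx ((p : ℤ_[p]) ^ M) (k + a) (k' + a) (hh p a k) (hh p a k') :=
  (Apx.prod (vinv p) ((-a).appr M + 1)).congr (hh_approx p a k M hM hk) (hh_approx p a k' M hM hk')

theorem intCast_dvd_iff (p : ℕ) [Fact p.Prime] (n : ℤ) :
    (p : ℤ_[p]) ∣ (n : ℤ_[p]) ↔ (p : ℤ) ∣ n := by
  rw [← PadicInt.norm_lt_one_iff_dvd]
  exact PadicInt.norm_int_lt_one_iff_dvd (p := p) n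

theorem prodV (p : ℕ) [hp : Fact p.Prime] (b b' : ℤ_[p]) (l : ℕ) (hl : l < p)
    (hb : (p : ℤ_[p]) * b' = b + l) (j : ℕ) :
    ∏ i ∈ Finset.range (l + p * j), V p (b + (i : ℤ_[p])) =
      (p : ℤ_[p]) ^ j * ∏ t ∈ Finset.range j, (b' + (t : ℤ_[p])) := by
  have hpos := hp.out.pos
  have hV : ∀ i : ℕ, ¬ (i ≡ l [MOD p]) → V p (b + (i : ℤ_[p])) = 1 := by
    intro i hi
    unfold V
    rw [if_neg]
    intro h
    apply hi
    have h1 : (p : ℤ_[p]) ∣ b + l := ⟨b', hb.symm⟩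
    have h2 := dvd_sub h1 h
    rw [Nat.modEq_iff_dvd, ← intCast_dvd_iff]
    push_cast
    rwa [add_sub_add_left_eq_sub] at h2
  induction j with
  | zero =>
    simp only [mul_zero, add_zero, pow_zero, Finset.range_zero, Finset.prod_empty, mul_one]
    apply Finset.prod_eq_one
    intro i hi
    rw [Finset.mem_range] at hi
    apply hV
    intro h
    have := Nat.ModEq.eq_of_lt_of_lt h (hi.trans hl) hl
    omega
  | succ j ih =>
    rw [mul_add, mul_one, ← add_assoc, Finset.prod_range_add, ih, Finset.prod_range_succ, pow_succ]
    obtain ⟨w, hw⟩ : ∃ w, p = w + 1 := ⟨p - 1, by omega⟩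
    have e : ∏ x ∈ Finset.range p, V p (b + ((l + p * j + x : ℕ) : ℤ_[p])) = p * (b' + j) := by
      have h0 : 0 ∈ Finset.range p := Finset.mem_range.2 hpos
      rw [Finset.prod_eq_single_of_mem 0 h0]
      · have : b + ((l + p * j + 0 : ℕ) : ℤ_[p]) = p * (b' + j) := by
          push_cast; linear_combination -hb
        rw [this]; unfold V; rw [if_pos (dvd_mul_right _ _)]
      · intro i hi hi0
        rw [Finset.mem_range] at hi
        apply hV
        intro h
        have h3 : i ≡ 0 [MOD p] := by
          have h4 : l + (p * j + i) ≡ l + 0 [MOD p] := by rw [← add_assoc]; exact h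
          have h5 := Nat.ModEq.add_left_cancel' l h4
          have h6 : p * j + i ≡ 0 + i [MOD p] := Nat.ModEq.add_right i (Nat.modEq_zero_iff_dvd.2 (dvd_mul_right p j))
          rw [zero_add] at h6
          exact h6.symm.trans h5
        exact hi0 (Nat.ModEq.eq_of_lt_of_lt h3 hi hpos)
    rw [e]; ring

theorem poch_eq (p : ℕ) [Fact p.Prime] (b : ℤ_[p]) (k : ℕ) :
    (ascPochhammer ℤ_[p] k).eval b = cu p b k * ∏ i ∈ Finset.range k, V p (b + (i : ℤ_[p])) := by
  unfold cu
  rw [← Finset.prod_mul_distrib]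
  simp only [U_mul_V]
  induction k with
  | zero => simp
  | succ n ih => rw [ascPochhammer_succ_eval, ih, Finset.prod_range_succ]

theorem poch_eq' (p : ℕ) [Fact p.Prime] (b : ℤ_[p]) (k : ℕ) :
    (ascPochhammer ℤ_[p] k).eval b = ∏ i ∈ Finset.range k, (b + (i : ℤ_[p])) := by
  rw [poch_eq]
  unfold cu
  rw [← Finset.prod_mul_distrib]
  simp only [U_mul_V]

theorem fact_eq (p : ℕ) [Fact p.Prime] (k : ℕ) :
    (k.factorial : ℤ_[p]) = (ascPochhammer ℤ_[p] k).eval 1 := by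
  rw [ascPochhammer_eval_one]

theorem prodV_one (p : ℕ) [hp : Fact p.Prime] (l : ℕ) (hl : l < p) (j : ℕ) :
    ∏ i ∈ Finset.range (l + p * j), V p (1 + (i : ℤ_[p])) =
      (p : ℤ_[p]) ^ j * (j.factorial : ℤ_[p]) := by
  have hpos := hp.out.pos
  have h := prodV p 1 1 (p - 1) (by omega) (by rw [Nat.cast_sub hpos]; push_cast; ring) j
  rw [fact_eq, poch_eq', ← h, show p - 1 + p * j = l + p * j + (p - 1 - l) by omega,
    Finset.prod_range_add _ (l + p * j)]
  have e : ∏ x ∈ Finset.range (p - 1 - l), V p (1 + ((l + p * j + x : ℕ) : ℤ_[p])) = 1 := by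
    apply Finset.prod_eq_one
    intro i hi
    rw [Finset.mem_range] at hi
    unfold V
    rw [if_neg]
    rw [show (1 : ℤ_[p]) + ((l + p * j + i : ℕ) : ℤ_[p]) = ((p * j + (l + i + 1) : ℕ) : ℤ_[p]) by
      push_cast; ring, natCast_dvd_iff, Nat.dvd_add_right (dvd_mul_right p j)]
    intro h
    have := Nat.le_of_dvd (by omega) h
    omega
  rw [e, mul_one]

theorem A_rel (p : ℕ) [hp : Fact p.Prime] (s : ℕ) (a a' : ℤ_[p])
    (l : ℕ) (hl : l < p) (hb : (p : ℤ_[p]) * a' = a + l) (j : ℕ)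
    (A A1 : ℕ → ℤ_[p]) (hA : IsHGCoeff p s a A) (hA1 : IsHGCoeff p s a' A1) :
    (-1) ^ (s * de p a) * A1 j = A (l + p * j) * hh p a (l + p * j) ^ s := by
  have h1 := hA (l + p * j)
  have h2 := hA1 j
  have h3 := hh_spec p a (l + p * j)
  rw [fact_eq, poch_eq, poch_eq, prodV p a a' l hl hb, prodV_one p l hl, mul_pow, mul_pow,
    mul_pow, mul_pow, ← poch_eq', ← h2] at h1
  have hp0 : (p : ℤ_[p]) ≠ 0 := PadicInt.prime_p.ne_zero
  have hj0 : (j.factorial : ℤ_[p]) ≠ 0 := by exact_mod_cast j.factorial_ne_zero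
  have h4 : cu p 1 (l + p * j) ^ s * A (l + p * j) = cu p a (l + p * j) ^ s * A1 j := by
    apply mul_left_cancel₀ (mul_ne_zero (pow_ne_zero s (pow_ne_zero j hp0)) (pow_ne_zero s hj0))
    linear_combination h1
  apply ((isUnit_cu p a (l + p * j)).pow s).mul_left_cancel
  have h5 : hh p a (l + p * j) ^ s * cu p a (l + p * j) ^ s =
      (-1) ^ (s * de p a) * cu p 1 (l + p * j) ^ s := by
    rw [← mul_pow, h3, mul_pow, ← pow_mul, mul_comm s]
  linear_combination (-1) ^ (s * de p a) * (-h4) - A (l + p * j) * h5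

theorem qpow_dvd (p : ℕ) [hp : Fact p.Prime] (i : ℕ) (hi : 2 ≤ i) :
    ∃ E : ℤ_[p], (qq p : ℤ_[p]) ^ i = (p : ℤ_[p]) ^ 2 * (i.factorial : ℤ_[p]) * E := by
  have hv := sub_one_mul_padicValNat_factorial_lt_of_ne_zero (p := p) (n := i) (by omega)
  obtain ⟨d, hd⟩ := pow_padicValNat_dvd (p := p) (n := i.factorial)
  have hnd : ¬ p ∣ d := by
    rintro ⟨t, rfl⟩
    apply pow_succ_padicValNat_not_dvd (p := p) i.factorial_ne_zero
    exact ⟨t, by rw [pow_succ, mul_assoc]; exact hd⟩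
  set v := padicValNat p i.factorial
  have hu : IsUnit (d : ℤ_[p]) :=
    isUnit_of_not_dvd p _ (fun h => hnd ((natCast_dvd_iff p d).1 h))
  obtain ⟨n, hn, hqn⟩ : ∃ n, v + 2 ≤ n ∧ (qq p) ^ i = p ^ n := by
    unfold qq
    rcases eq_or_ne p 2 with h2 | h2
    · refine ⟨2 * i, ?_, ?_⟩
      · rw [h2] at hv; omega
      · rw [if_pos h2, h2, pow_mul]; norm_num
    · refine ⟨i, ?_, by rw [if_neg h2]⟩
      have h3 : 3 ≤ p := by have := hp.out.two_le; omega
      have : 2 * v ≤ (p - 1) * v := Nat.mul_le_mul_right _ (by omega)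
      omega
  obtain ⟨t, rfl⟩ := Nat.exists_eq_add_of_le hn
  refine ⟨(p : ℤ_[p]) ^ t * Ring.inverse (d : ℤ_[p]), ?_⟩
  have hqn' : (qq p : ℤ_[p]) ^ i = (p : ℤ_[p]) ^ (v + 2 + t) := by exact_mod_cast hqn
  rw [hqn', hd]
  have := Ring.mul_inverse_cancel _ hu
  push_cast
  rw [pow_add, pow_add]
  linear_combination -(p : ℤ_[p]) ^ v * (p : ℤ_[p]) ^ 2 * (p : ℤ_[p]) ^ t * this

theorem descFac_eq {R : Type*} [CommRing R] (n i : ℕ) :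
    ((n.descFactorial (i + 1) : ℕ) : R) = n * ∏ j ∈ Finset.range i, ((n : R) - (j + 1)) := by
  induction i with
  | zero => simp
  | succ i ih =>
    rw [Nat.descFactorial_succ, Finset.prod_range_succ, ← mul_assoc, ← ih, Nat.cast_mul]
    rcases le_or_gt (i + 1) n with h | h
    · rw [Nat.cast_sub h]; push_cast; ring
    · rw [Nat.descFactorial_of_lt h]; simp

theorem cpow_poly (p : ℕ) [hp : Fact p.Prime] (u c : Wp p) (hc : c = 1 + (qq p : Wp p) * u)
    (N : ℕ) : ∃ (c0 : Wp p) (T : Polynomial (Wp p)), ∀ n ≤ N,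
      c ^ n = 1 + p * n * (c0 + p * T.eval (n : Wp p)) := by
  have hE : ∀ i : ℕ, ∃ E : Wp p, (qq p : Wp p) ^ (i + 2) =
      (p : Wp p) ^ 2 * ((i + 2).factorial : Wp p) * E := by
    intro i
    obtain ⟨E, hE⟩ := qpow_dvd p (i + 2) (by omega)
    refine ⟨iota p E, ?_⟩
    have := congrArg (iota p) hE
    simpa using this
  choose E hE using hE
  obtain ⟨q0, hq0⟩ : ∃ q0 : ℕ, qq p = p * q0 := by
    unfold qq; split_ifs with h
    · exact ⟨2, by rw [h]⟩
    · exact ⟨1, by simp⟩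
  refine ⟨q0 * u, ∑ i ∈ Finset.range N, Polynomial.C (E i * u ^ (i + 2)) *
    ∏ j ∈ Finset.range (i + 1), (Polynomial.X - Polynomial.C ((j : Wp p) + 1)), ?_⟩
  intro n hn
  have e1 : c ^ n = ∑ i ∈ Finset.range (N + 2), ((qq p : Wp p) * u) ^ i * (n.choose i : Wp p) := by
    rw [hc, add_comm, add_pow]
    simp only [one_pow, mul_one]
    apply Finset.sum_subset
    · intro x; simp only [Finset.mem_range]; omega
    · intro x _ hx
      simp only [Finset.mem_range] at hx
      rw [Nat.choose_eq_zero_of_lt (by omega)]; simp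
  rw [e1, Finset.sum_range_succ', Finset.sum_range_succ']
  have e2 : ∀ i, ((qq p : Wp p) * u) ^ (i + 1 + 1) * (n.choose (i + 1 + 1) : Wp p) =
      p * n * (p * (E i * u ^ (i + 2) * ∏ j ∈ Finset.range (i + 1), ((n : Wp p) - (j + 1)))) := by
    intro i
    have h1 := descFac_eq (R := Wp p) n (i + 1)
    rw [Nat.descFactorial_eq_factorial_mul_choose] at h1
    push_cast at h1
    rw [mul_pow, show i + 1 + 1 = i + 2 from rfl, hE]
    rw [show i + 1 + 1 = i + 2 from rfl] at h1
    linear_combination (p : Wp p) ^ 2 * E i * u ^ (i + 2) * h1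
  rw [Finset.sum_congr rfl (fun i _ => e2 i), ← Finset.mul_sum, ← Finset.mul_sum]
  simp only [Polynomial.eval_finsetSum, Polynomial.eval_mul, Polynomial.eval_prod,
    Polynomial.eval_sub, Polynomial.eval_C, Polynomial.eval_X]
  rw [hq0]
  simp
  ring

theorem iota_appr (p : ℕ) [hp : Fact p.Prime] (n : ℤ_[p]) (M : ℕ) :
    (p : Wp p) ^ M ∣ iota p n - (n.appr M : Wp p) := by
  have := map_dvd (iota p) (Ideal.mem_span_singleton.1 (PadicInt.appr_spec M n))
  simpa using this

theorem cpw_Apx (p : ℕ) [hp : Fact p.Prime] (u c : Wp p) (hc : c = 1 + (qq p : Wp p) * u)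
    (cpw : ℤ_[p] → Wp p) (hcpw : IsCpow p c cpw) (n n' : ℤ_[p]) (M : ℕ) :
    Apx ((p : Wp p) ^ M) (p * iota p n) (p * iota p n') (cpw n) (cpw n') := by
  obtain ⟨c0, T, hT⟩ := cpow_poly p u c hc (max (n.appr M) (n'.appr M))
  have key : ∀ m : ℤ_[p], m.appr M ≤ max (n.appr M) (n'.appr M) →
      (p : Wp p) ^ M ∣ cpw m - (1 - p * iota p m * (-(c0 + p * T.eval (iota p m)))) := by
    intro m hm
    have h1 := Ideal.mem_span_singleton.1 (hcpw m M)
    rw [hT _ hm] at h1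
    obtain ⟨x, hx⟩ := h1
    obtain ⟨y, hy⟩ := iota_appr p m M
    obtain ⟨w, hw⟩ := (iota_appr p m M).trans (Polynomial.sub_dvd_eval_sub _ _ T)
    refine ⟨x - p * y * (c0 + p * T.eval (iota p m)) - p * (m.appr M : Wp p) * p * w, ?_⟩
    linear_combination hx - p * (c0 + p * T.eval (iota p m)) * hy - p * (m.appr M : Wp p) * p * hw
  refine ⟨_, _, key n (le_max_left _ _), key n' (le_max_right _ _), ?_⟩
  obtain ⟨w, hw⟩ := Polynomial.sub_dvd_eval_sub (iota p n) (iota p n') T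
  exact ⟨-w, by linear_combination -(p : Wp p) * hw⟩

theorem cond_iff (p : ℕ) [hp : Fact p.Prime] (a : ℤ_[p]) (k : ℕ) :
    (dl p a ≤ k ∧ p ∣ (k - dl p a)) ↔ (p : ℤ_[p]) ∣ k + a := by
  have hl : dl p a < p := by simpa [dl] using PadicInt.appr_lt (-a) 1
  have h0 : (p : ℤ_[p]) ∣ -a - (dl p a : ℤ_[p]) := by
    simpa [dl] using Ideal.mem_span_singleton.1 (PadicInt.appr_spec 1 (-a))
  have h1 : (p : ℤ_[p]) ∣ k + a ↔ (p : ℤ) ∣ (k : ℤ) - (dl p a : ℤ) := by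
    rw [← intCast_dvd_iff, ← dvd_add_right h0, ← dvd_neg]
    rw [← dvd_neg]
    push_cast
    rw [show - -(-a - (dl p a : ℤ_[p]) + (k + a)) = (k : ℤ_[p]) - dl p a by ring]
  rw [h1]
  constructor
  · rintro ⟨h2, h3⟩
    rw [← Nat.cast_sub h2]
    exact_mod_cast h3
  · intro h
    have h2 : dl p a ≤ k := by
      by_contra hlt
      push Not at hlt
      have h4 : (p : ℤ) ∣ (dl p a : ℤ) - k := by rw [← dvd_neg, neg_sub]; exact h
      have := Int.le_of_dvd (by omega) h4
      omega
    refine ⟨h2, ?_⟩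
    rw [← Nat.cast_sub h2] at h
    exact_mod_cast h

theorem dvd_p_pow (p : ℕ) [hp : Fact p.Prime] (x : ℤ_[p]) (hx : x ≠ 0) :
    ∃ N : ℕ, x ∣ (p : ℤ_[p]) ^ N := by
  refine ⟨x.valuation, Ring.inverse (PadicInt.unitCoeff hx : ℤ_[p]), ?_⟩
  have h1 := PadicInt.unitCoeff_spec hx
  have h2 := Ring.mul_inverse_cancel _ (PadicInt.unitCoeff hx).isUnit
  linear_combination -(p : ℤ_[p]) ^ x.valuation * h2 -
    Ring.inverse (PadicInt.unitCoeff hx : ℤ_[p]) * h1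

theorem iotaK_inj (p : ℕ) [hp : Fact p.Prime] : Function.Injective (iotaK p) :=
  IsFractionRing.injective (Wp p) (Kp p)

theorem iota_ne_zero (p : ℕ) [hp : Fact p.Prime] (x : ℤ_[p]) (hx : x ≠ 0) : iota p x ≠ 0 := by
  obtain ⟨N, hN⟩ := dvd_p_pow p x hx
  have h := map_dvd (iota p) hN
  rw [map_pow, map_natCast] at h
  intro h0
  rw [h0, zero_dvd_iff] at h
  exact WittVector.p_nonzero p (Fbar p) (by by_contra h2; exact pow_ne_zero N h2 h)

theorem iotaK_ne_zero (p : ℕ) [hp : Fact p.Prime] (x : ℤ_[p]) (hx : x ≠ 0) :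
    iotaK p (iota p x) ≠ 0 := by
  intro h
  apply iota_ne_zero p x hx
  apply iotaK_inj p
  rw [h, map_zero]

theorem A_ne_zero (p : ℕ) [hp : Fact p.Prime] (s : ℕ) (a : ℤ_[p]) (ha : NotNonposInt p a)
    (A : ℕ → ℤ_[p]) (hA : IsHGCoeff p s a A) (k : ℕ) : A k ≠ 0 := by
  intro h
  have h1 := hA k
  rw [h, mul_zero, poch_eq'] at h1
  exact pow_ne_zero s (Finset.prod_ne_zero_iff.2 fun i _ => ha i) h1.symm

theorem f_unit (p : ℕ) [hp : Fact p.Prime] (s : ℕ) (a a' : ℤ_[p]) (ha : NotNonposInt p a)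
    (A A1 : ℕ → ℤ_[p]) (hA : IsHGCoeff p s a A) (cpw : ℤ_[p] → Wp p) (k : ℕ)
    (hk : ¬ (p : ℤ_[p]) ∣ k + a) :
    BhatK p s a a' A A1 cpw k / iotaK p (iota p (A k)) =
      iotaK p (iota p (Ring.inverse ((k : ℤ_[p]) + a))) := by
  have hA0 := iotaK_ne_zero p _ (A_ne_zero p s a ha A hA k)
  have hu := isUnit_of_not_dvd p _ hk
  have h1 := congrArg (fun x => iotaK p (iota p x)) (Ring.mul_inverse_cancel _ hu)
  simp only [map_mul, map_one, map_add, map_natCast] at h1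
  unfold BhatK
  rw [if_neg (fun h => hk ((cond_iff p a k).1 h)), sub_zero, mul_div_assoc, div_self hA0, mul_one]
  exact inv_eq_of_mul_eq_one_right h1

theorem f_main (p : ℕ) [hp : Fact p.Prime] (s : ℕ) (a a' : ℤ_[p]) (ha : NotNonposInt p a)
    (ha' : IsDworkPrime p a a')
    (A A1 : ℕ → ℤ_[p]) (hA : IsHGCoeff p s a A) (hA1 : IsHGCoeff p s a' A1)
    (cpw : ℤ_[p] → Wp p) (k : ℕ) (hk : (p : ℤ_[p]) ∣ k + a) :
    ∃ n : ℤ_[p], (p : ℤ_[p]) * n = k + a ∧ ∀ F : Wp p,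
      1 - iota p (hh p a k) ^ s * cpw n = iota p (k + a) * F →
      BhatK p s a a' A A1 cpw k / iotaK p (iota p (A k)) = iotaK p F := by
  have hA0 := iotaK_ne_zero p _ (A_ne_zero p s a ha A hA k)
  have hl : dl p a < p := by simpa [dl] using PadicInt.appr_lt (-a) 1
  have hc := (cond_iff p a k).2 hk
  unfold BhatK
  rw [if_pos hc]
  obtain ⟨h1, j, hj⟩ := hc
  have hj' : (k - dl p a) / p = j := by rw [hj, Nat.mul_div_cancel_left _ hp.out.pos]
  have hkj : k = dl p a + p * j := by omega
  have hz : ((k : ℕ) : ℤ_[p]) = dl p a + p * j := by exact_mod_cast hkj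
  rw [hj']
  have hz0 : iotaK p (iota p ((k : ℤ_[p]) + a)) ≠ 0 :=
    iotaK_ne_zero p _ (by rw [add_comm]; exact ha k)
  refine ⟨j + a', ?_, ?_⟩
  · unfold IsDworkPrime at ha'
    rw [mul_add, ha', hz]; ring
  · intro F hF
    have hrel := A_rel p s a a' (dl p a) hl ha' j A A1 hA hA1
    rw [← hkj] at hrel
    have hrel' := congrArg (fun x => iotaK p (iota p x)) hrel
    have hF' := congrArg (iotaK p) hF
    simp only [map_mul, map_one, map_add, map_sub, map_natCast, map_pow, map_neg] at hrel' hF' hz0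
    rw [hrel', div_eq_iff hA0, inv_mul_eq_iff_eq_mul₀ hz0]
    linear_combination (iotaK p (iota p (A k))) * hF'

theorem pair_main (p : ℕ) [Fact p.Prime] (s : ℕ)
    (a a' : ℤ_[p]) (ha : NotNonposInt p a) (ha' : IsDworkPrime p a a')
    (A A1 : ℕ → ℤ_[p]) (hA : IsHGCoeff p s a A) (hA1 : IsHGCoeff p s a' A1)
    (u c : Wp p) (hc : c = 1 + (qq p : Wp p) * u)
    (cpw : ℤ_[p] → Wp p) (hcpw : IsCpow p c cpw) (k k' m : ℕ)
    (hk : (p : ℤ_[p]) ∣ k + a) (hk' : (p : ℤ_[p]) ∣ k' + a)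
    (hm : (p : ℤ) ^ m ∣ (k : ℤ) - (k' : ℤ)) :
    ∃ F F' : Wp p, BhatK p s a a' A A1 cpw k / iotaK p (iota p (A k)) = iotaK p F ∧
      BhatK p s a a' A A1 cpw k' / iotaK p (iota p (A k')) = iotaK p F' ∧
      (p : Wp p) ^ m ∣ F - F' := by
  obtain ⟨n, hn, h1⟩ := f_main p s a a' ha ha' A A1 hA hA1 cpw k hk
  obtain ⟨n', hn', h1'⟩ := f_main p s a a' ha ha' A A1 hA hA1 cpw k' hk'
  obtain ⟨N, hN⟩ := dvd_p_pow p ((k : ℤ_[p]) + a) (by rw [add_comm]; exact ha k)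
  obtain ⟨N', hN'⟩ := dvd_p_pow p ((k' : ℤ_[p]) + a) (by rw [add_comm]; exact ha k')
  have hNW := map_dvd (iota p) (hN.trans (pow_dvd_pow _ (le_max_left N N')))
  have hNW' := map_dvd (iota p) (hN'.trans (pow_dvd_pow _ (le_max_right N N')))
  rw [map_pow, map_natCast] at hNW hNW'
  have hd : (p : Wp p) ^ m ∣ iota p (k + a) - iota p (k' + a) := by
    have := map_dvd (Int.castRingHom (Wp p)) hm
    simpa using this
  obtain ⟨F, F', e, e', hFF⟩ := Apx.final (p : Wp p) (iota p (k + a)) (iota p (k' + a))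
    (iota p (hh p a k) ^ s * cpw n) (iota p (hh p a k') ^ s * cpw n') (max N N') m hNW hNW' hd (by
      intro M hM
      have x1 := ((hh_Apx p a k k' M hM hk hk').map (iota p)).pow s
      have x2 := cpw_Apx p u c hc cpw hcpw n n' M
      rw [map_pow, map_natCast] at x1
      rw [← map_natCast (iota p) p, ← map_mul, ← map_mul, hn, hn', map_natCast] at x2
      exact x1.mul x2)
  exact ⟨F, F', h1 F e, h1' F' e', hFF⟩

/-- the function `k ↦ B_k/A_k` is Lipschitz. -/
theorem statement6 (p : ℕ) [Fact p.Prime] (s : ℕ) (hs : 1 ≤ s)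
    (a a' : ℤ_[p]) (ha : NotNonposInt p a) (ha' : IsDworkPrime p a a')
    (A A1 : ℕ → ℤ_[p]) (hA : IsHGCoeff p s a A) (hA1 : IsHGCoeff p s a' A1)
    (u c : Wp p) (hc : c = 1 + (qq p : Wp p) * u)
    (cpw : ℤ_[p] → Wp p) (hcpw : IsCpow p c cpw) :
    LipschitzSeq p
      (fun k => BhatK p s a a' A A1 cpw k / iotaK p (iota p (A k))) := by
  constructor
  · intro k
    by_cases hk : (p : ℤ_[p]) ∣ k + a
    · obtain ⟨F, _, h, _⟩ := pair_main p s a a' ha ha' A A1 hA hA1 u c hc cpw hcpw k k 0 hk hk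
        (by simp)
      exact ⟨F, h.symm⟩
    · exact ⟨_, (f_unit p s a a' ha A A1 hA cpw k hk).symm⟩
  · intro k k' m hm
    suffices h : ∃ F F' : Wp p, BhatK p s a a' A A1 cpw k / iotaK p (iota p (A k)) = iotaK p F ∧
        BhatK p s a a' A A1 cpw k' / iotaK p (iota p (A k')) = iotaK p F' ∧
        (p : Wp p) ^ m ∣ F - F' by
      obtain ⟨F, F', h1, h2, w, hw⟩ := h
      refine ⟨w, ?_⟩
      simp only [h1, h2]
      rw [← map_sub, hw, map_mul, map_pow, map_natCast]
    have hd : (p : ℤ_[p]) ^ m ∣ (k : ℤ_[p]) - k' := by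
      have := map_dvd (Int.castRingHom ℤ_[p]) hm
      simpa using this
    have hunit : ∀ i : ℕ, ¬ (p : ℤ_[p]) ∣ i + a → ∃ F : Wp p,
        BhatK p s a a' A A1 cpw i / iotaK p (iota p (A i)) = iotaK p F :=
      fun i hi => ⟨_, f_unit p s a a' ha A A1 hA cpw i hi⟩
    have hdiv : ∀ i : ℕ, (p : ℤ_[p]) ∣ i + a → ∃ F : Wp p,
        BhatK p s a a' A A1 cpw i / iotaK p (iota p (A i)) = iotaK p F := by
      intro i hi
      obtain ⟨F, _, h, _⟩ := pair_main p s a a' ha ha' A A1 hA hA1 u c hc cpw hcpw i i 0 hi hi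
        (by simp)
      exact ⟨F, h⟩
    rcases Nat.eq_zero_or_pos m with h0 | h0
    · have hall : ∀ i : ℕ, ∃ F : Wp p,
          BhatK p s a a' A A1 cpw i / iotaK p (iota p (A i)) = iotaK p F :=
        fun i => (em _).elim (hdiv i) (hunit i)
      obtain ⟨F, hF⟩ := hall k
      obtain ⟨F', hF'⟩ := hall k'
      exact ⟨F, F', hF, hF', by simp [h0]⟩
    have hiff : (p : ℤ_[p]) ∣ k + a ↔ (p : ℤ_[p]) ∣ k' + a := by
      rw [show (k : ℤ_[p]) + a = (k - k') + (k' + a) by ring]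
      exact dvd_add_right ((dvd_pow_self _ (by omega)).trans hd)
    by_cases hk : (p : ℤ_[p]) ∣ k + a
    · exact pair_main p s a a' ha ha' A A1 hA hA1 u c hc cpw hcpw k k' m hk (hiff.1 hk) hm
    · have hk' := fun h => hk (hiff.2 h)
      refine ⟨_, _, f_unit p s a a' ha A A1 hA cpw k hk, f_unit p s a a' ha A A1 hA cpw k' hk', ?_⟩
      have h1 := Ring.mul_inverse_cancel _ (isUnit_of_not_dvd p _ hk)
      have h2 := Ring.mul_inverse_cancel _ (isUnit_of_not_dvd p _ hk')
      obtain ⟨w, hw⟩ := hd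
      have h3 : (p : ℤ_[p]) ^ m ∣
          Ring.inverse ((k : ℤ_[p]) + a) - Ring.inverse ((k' : ℤ_[p]) + a) := by
        refine ⟨-(Ring.inverse ((k : ℤ_[p]) + a) * Ring.inverse ((k' : ℤ_[p]) + a) * w), ?_⟩
        linear_combination (-Ring.inverse ((k : ℤ_[p]) + a)) * h2 +
          Ring.inverse ((k' : ℤ_[p]) + a) * h1 -
          Ring.inverse ((k : ℤ_[p]) + a) * Ring.inverse ((k' : ℤ_[p]) + a) * hw
      have h4 := map_dvd (iota p) h3
      rw [map_pow, map_natCast, map_sub] at h4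
      exact h4

end HGP
end

section
/- Let p be a prime, a ∈ ℤ_p ∖ ℤ_{≤0}, s = 1 and c = 1. For k ∈ ℤ_{≥0} put A_k := (a)_k/k!, A^{(1)}_m := (a′)_m/m!, and B_k := (k+a)^{−1}(A_k − (−1)^e A^{(1)}_{(k−l)/p}), with the convention A^{(1)}_{(k−l)/p} := 0 unless k ≥ l and k ≡ l mod p. If k = l + b p^m with b ∈ ℤ_{≥1}, p ∤ b and m ≥ 1, then B_k/A_k ≡ B_l/A_l mod p^mℤ_p. -/
open scoped Classical

namespace HGP

section Helpers

/-- `P(x) = ∏_{j=1}^{p-1} (x + j)`. -/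
def PP (p : ℕ) {R : Type*} [CommRing R] (x : R) : R :=
  ∏ j ∈ Finset.range (p - 1), (x + ((j + 1 : ℕ) : R))

/-- `Q(x,n) = ∏_{i<n} P(x + p i)`. -/
def QQ (p : ℕ) {R : Type*} [CommRing R] (x : R) (n : ℕ) : R :=
  ∏ i ∈ Finset.range n, PP p (x + ((p * i : ℕ) : R))

/-- `E(x) = ∏_{j=1}^{l} (x + j)`. -/
def EE (l : ℕ) {R : Type*} [CommRing R] (x : R) : R :=
  ∏ j ∈ Finset.range l, (x + ((j + 1 : ℕ) : R))

lemma QQ_add (p : ℕ) {R : Type*} [CommRing R] (x : R) (m n : ℕ) :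
    QQ p x (m + n) = QQ p x m * QQ p (x + ((p * m : ℕ) : R)) n := by
  unfold QQ
  rw [Finset.prod_range_add]
  congr 1
  apply Finset.prod_congr rfl
  intro i _
  congr 1
  push_cast
  ring

lemma PP_refl (p : ℕ) (hp : 1 ≤ p) {R : Type*} [CommRing R] (x : R) :
    PP p (-x - (p : R)) = (-1) ^ (p - 1) * PP p x := by
  unfold PP
  rw [← Finset.prod_range_reflect]
  conv_lhs => rw [Finset.prod_congr rfl (g := fun j => (-1 : R) * (x + ((j + 1 : ℕ) : R))) (by
    intro j hj
    rw [Finset.mem_range] at hj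
    have : ((p - 1 - 1 - j + 1 : ℕ) : R) = (p : R) - ((j + 1 : ℕ) : R) := by
      rw [← Nat.cast_sub (by omega)]
      congr 1
      omega
    rw [this]
    ring)]
  rw [Finset.prod_mul_distrib]
  simp

lemma QQ_refl (p : ℕ) (hp : 1 ≤ p) {R : Type*} [CommRing R] (M : ℕ) :
    QQ p (-((p * M : ℕ) : R)) M = (-1) ^ (M * (p - 1)) * QQ p (0 : R) M := by
  unfold QQ
  rw [← Finset.prod_range_reflect]
  conv_lhs => rw [Finset.prod_congr rfl
      (g := fun i => (-1 : R) ^ (p - 1) * PP p (0 + ((p * i : ℕ) : R))) (by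
    intro i hi
    rw [Finset.mem_range] at hi
    rw [← PP_refl p hp]
    congr 1
    have : ((p * (M - 1 - i) : ℕ) : R) = ((p * M : ℕ) : R) - ((p * (i + 1) : ℕ) : R) := by
      rw [← Nat.cast_sub (by gcongr; omega), ← Nat.mul_sub]
      congr 2
      omega
    rw [this]
    push_cast
    ring)]
  rw [Finset.prod_mul_distrib]
  simp [← pow_mul, mul_comm]

lemma EE_poch (l : ℕ) {R : Type*} [CommRing R] (x : R) :
    ∏ j ∈ Finset.range l, (x + (j : R)) = (-1) ^ l * EE l (-(x + (l : R))) := by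
  unfold EE
  rw [← Finset.prod_range_reflect]
  rw [Finset.prod_congr rfl (g := fun j => (-1 : R) * (-(x + (l : R)) + ((j + 1 : ℕ) : R))) (by
    intro j hj
    rw [Finset.mem_range] at hj
    have : ((l - 1 - j : ℕ) : R) = (l : R) - ((j + 1 : ℕ) : R) := by
      rw [← Nat.cast_sub (by omega)]
      congr 1
      omega
    rw [this]
    ring)]
  rw [Finset.prod_mul_distrib]
  simp

lemma poch_prod {R : Type*} [CommRing R] (x : R) (k : ℕ) :
    (ascPochhammer R k).eval x = ∏ j ∈ Finset.range k, (x + (j : R)) := by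
  induction k with
  | zero => simp
  | succ k ih => rw [ascPochhammer_succ_eval, ih, Finset.prod_range_succ]

lemma block (p : ℕ) (hp : 1 ≤ p) {R : Type*} [CommRing R] (x : R) (n : ℕ) :
    ∏ j ∈ Finset.range (p * n), ((p : R) * x + (j : R)) =
      QQ p ((p : R) * x) n * (p : R) ^ n * ∏ i ∈ Finset.range n, (x + (i : R)) := by
  induction n with
  | zero => simp [QQ]
  | succ n ih =>
    rw [mul_add, mul_one, Finset.prod_range_add, ih, QQ_add, Finset.prod_range_succ (n := n)]
    have h1 : ∏ j ∈ Finset.range p, ((p : R) * x + ((p * n + j : ℕ) : R)) =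
        PP p ((p : R) * x + ((p * n : ℕ) : R)) * ((p : R) * (x + n)) := by
      obtain ⟨q, rfl⟩ : ∃ q, p = q + 1 := ⟨p - 1, by omega⟩
      rw [Finset.prod_range_succ']
      unfold PP
      simp only [Nat.add_sub_cancel]
      congr 1
      · apply Finset.prod_congr rfl
        intro i _
        push_cast
        ring
      · push_cast
        ring
    rw [h1]
    simp only [QQ, Finset.range_one, Finset.prod_singleton, mul_zero, Nat.cast_zero, add_zero]
    ring

lemma poch_split (p : ℕ) (hp : 1 ≤ p) {R : Type*} [CommRing R] (a a' : R) (l n : ℕ)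
    (h : (p : R) * a' = a + (l : R)) :
    (ascPochhammer R (l + p * n)).eval a =
      ((-1) ^ l * EE l (-((p : R) * a'))) * QQ p ((p : R) * a') n * (p : R) ^ n *
        (ascPochhammer R n).eval a' := by
  rw [poch_prod, poch_prod, Finset.prod_range_add, EE_poch, h]
  rw [← h]
  have := block p hp a' n
  have e : ∀ u v w t : R, u * v * w * t = u * (v * w * t) := by intros; ring
  rw [e, ← this]
  congr 1
  apply Finset.prod_congr rfl
  intro i _
  rw [h]
  push_cast
  ring

lemma fact_split (p : ℕ) (hp : 1 ≤ p) {R : Type*} [CommRing R] (l n : ℕ) :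
    ((l + p * n).factorial : R) =
      EE l ((p * n : ℕ) : R) * QQ p (0 : R) n * (p : R) ^ n * (n.factorial : R) := by
  have h0 : ∀ N : ℕ, ((N.factorial : ℕ) : R) = ∏ j ∈ Finset.range N, ((j + 1 : ℕ) : R) := by
    intro N
    rw [← Finset.prod_range_add_one_eq_factorial]
    push_cast
    rfl
  have h1 : (((p * n).factorial : ℕ) : R) = QQ p (0 : R) n * (p : R) ^ n * (n.factorial : R) := by
    induction n with
    | zero => simp [QQ]
    | succ n ih =>
      rw [h0, mul_add, mul_one, Finset.prod_range_add, ← h0, ih, QQ_add, Nat.factorial_succ]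
      have h1 : ∏ j ∈ Finset.range p, ((p * n + j + 1 : ℕ) : R) =
          PP p (0 + ((p * n : ℕ) : R)) * ((p : R) * (n + 1)) := by
        obtain ⟨q, rfl⟩ : ∃ q, p = q + 1 := ⟨p - 1, by omega⟩
        rw [Finset.prod_range_succ]
        unfold PP
        simp only [Nat.add_sub_cancel]
        congr 1
        · apply Finset.prod_congr rfl
          intro i _
          push_cast
          ring
        · push_cast
          ring
      rw [h1]
      simp only [QQ, Finset.range_one, Finset.prod_singleton, mul_zero, Nat.cast_zero, add_zero]
      push_cast
      ring
  rw [mul_assoc, mul_assoc, ← mul_assoc (QQ _ _ _), ← h1, h0, add_comm, Finset.prod_range_add,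
    ← h0, mul_comm]
  unfold EE
  congr 1
  apply Finset.prod_congr rfl
  intro i _
  push_cast
  ring

open Polynomial in
lemma eval_EE (l : ℕ) {R : Type*} [CommRing R] (f : R[X]) (x : R) :
    (EE l f).eval x = EE l (f.eval x) := by
  simp [EE, eval_prod]

open Polynomial in
lemma eval_QQ (p : ℕ) {R : Type*} [CommRing R] (f : R[X]) (x : R) (n : ℕ) :
    (QQ p f n).eval x = QQ p (f.eval x) n := by
  simp [QQ, PP, eval_prod]

lemma unit_aux (p : ℕ) [hp : Fact p.Prime] (x : ℤ_[p]) (hx : (p : ℤ_[p]) ∣ x) (j : ℕ)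
    (h1 : 1 ≤ j) (h2 : j < p) : IsUnit (x + (j : ℤ_[p])) := by
  by_contra h
  rw [← mem_nonunits_iff, PadicInt.mem_nonunits, PadicInt.norm_lt_one_iff_dvd] at h
  have h3 : ((p : ℤ_[p])) ^ 1 ∣ ((j : ℤ) : ℤ_[p]) := by
    have := dvd_sub h hx
    simpa using this
  rw [PadicInt.pow_p_dvd_int_iff] at h3
  have h4 : p ∣ j := by
    have : (p : ℤ) ∣ (j : ℤ) := by simpa using h3
    exact_mod_cast this
  exact absurd (Nat.le_of_dvd h1 h4) (by omega)

lemma unit_EE (p : ℕ) [hp : Fact p.Prime] (x : ℤ_[p]) (hx : (p : ℤ_[p]) ∣ x) (l : ℕ)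
    (h2 : l < p) : IsUnit (EE l x) := by
  unfold EE
  rw [IsUnit.prod_iff]
  intro j hj
  rw [Finset.mem_range] at hj
  exact unit_aux p x hx (j + 1) (by omega) (by omega)

lemma unit_QQ (p : ℕ) [hp : Fact p.Prime] (x : ℤ_[p]) (hx : (p : ℤ_[p]) ∣ x) (n : ℕ) :
    IsUnit (QQ p x n) := by
  unfold QQ
  rw [IsUnit.prod_iff]
  intro i _
  have := hp.out.two_le
  refine unit_EE p _ (dvd_add hx ?_) (p - 1) (by omega)
  push_cast
  exact dvd_mul_right _ _

/-- the cross-multiplied difference -/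
def TT (p l n : ℕ) {R : Type*} [CommRing R] (s x : R) : R :=
  (((-1) ^ l * EE l (-x)) * QQ p x n - s * (EE l ((p * n : ℕ) : R) * QQ p 0 n)) * x
      * ((-1) ^ l * EE l (-x))
    - ((-1) ^ l * EE l (-x) - s * EE l 0) * (x + ((p * n : ℕ) : R))
      * (((-1) ^ l * EE l (-x)) * QQ p x n)

open Polynomial in
lemma TT_congr (p l n : ℕ) {R : Type*} [CommRing R] (s x y : R) :
    x - y ∣ TT p l n s x - TT p l n s y := by
  have h : ∀ z : R, (TT p l n (C s) (X : R[X])).eval z = TT p l n s z := by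
    intro z
    simp [TT, eval_EE, eval_QQ]
  rw [← h, ← h]
  exact sub_dvd_eval_sub _ _ _

open Polynomial in
lemma TT_nat (p l n M : ℕ) [hp : Fact p.Prime] (s : ℤ_[p])
    (hs : (-1) ^ l * (-1) ^ (M * (p - 1)) = s) :
    ((p * n : ℕ) : ℤ_[p]) * (((p * M : ℕ) : ℤ_[p]) * (((p * M : ℕ) : ℤ_[p]) + ((p * n : ℕ) : ℤ_[p])))
      ∣ TT p l n s ((p * M : ℕ) : ℤ_[p]) := by
  set z : ℤ_[p] := ((p * M : ℕ) : ℤ_[p]) with hz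
  set w : ℤ_[p] := ((p * n : ℕ) : ℤ_[p]) with hw
  let D : ℤ_[p][X] := C ((-1) ^ l * EE l (-z)) * QQ p X M
  let N : ℤ_[p][X] := C (s * QQ p 0 M) * EE l X
  have hD : ∀ x, D.eval x = (-1) ^ l * EE l (-z) * QQ p x M := by
    intro x; simp [D, eval_QQ]
  have hN : ∀ x, N.eval x = s * QQ p 0 M * EE l x := by
    intro x; simp [N, eval_EE]
  have hroot : (D - N).IsRoot (-z) := by
    rw [IsRoot.def, eval_sub, hD, hN, hz, QQ_refl p hp.out.one_le, ← hs]
    ring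
  obtain ⟨G, hG⟩ := dvd_iff_isRoot.mpr hroot
  have hG' : ∀ x, D.eval x - N.eval x = (x + z) * G.eval x := by
    intro x
    rw [← eval_sub, hG]
    simp
  have hu : IsUnit (QQ p (0 : ℤ_[p]) M) := unit_QQ p 0 (dvd_zero _) M
  have hQ : QQ p z n * QQ p 0 M = QQ p 0 n * QQ p w M := by
    have h1 := QQ_add p (0 : ℤ_[p]) M n
    have h2 := QQ_add p (0 : ℤ_[p]) n M
    rw [add_comm n M] at h2
    rw [zero_add] at h1 h2
    rw [hz, hw, ← h2, h1]
    ring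
  have h0 := hG' 0
  have h1 := hG' w
  have key : TT p l n s z * (QQ p (0 : ℤ_[p]) M) ^ 2 =
      QQ p 0 n * (z * (z + w)) * (G.eval w * D.eval 0 - G.eval 0 * D.eval w) := by
    have e1 : QQ p 0 n * (z * (z + w)) * (G.eval w * D.eval 0 - G.eval 0 * D.eval w) =
        QQ p 0 n * (D.eval w - N.eval w) * z * D.eval 0
          - (D.eval 0 - N.eval 0) * (z + w) * (QQ p 0 n * D.eval w) := by
      rw [h0, h1]; ring
    have e2 : QQ p 0 n * D.eval w = (-1) ^ l * EE l (-z) * (QQ p z n * QQ p 0 M) := by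
      rw [hD, hQ]; ring
    rw [e1, mul_sub (QQ p 0 n), e2, hD, hN, hN]
    unfold TT
    rw [← hw]
    ring
  have hd : w ∣ G.eval w * D.eval 0 - G.eval 0 * D.eval w := by
    have hd1 := sub_dvd_eval_sub w 0 G
    have hd2 := sub_dvd_eval_sub w 0 D
    rw [sub_zero] at hd1 hd2
    have : G.eval w * D.eval 0 - G.eval 0 * D.eval w =
      (G.eval w - G.eval 0) * D.eval 0 - G.eval 0 * (D.eval w - D.eval 0) := by ring
    rw [this]
    exact dvd_sub (hd1.mul_right _) (hd2.mul_left _)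
  rw [← (hu.pow 2).dvd_mul_right, key]
  obtain ⟨c, hc⟩ := hd
  rw [hc]
  exact ⟨QQ p 0 n * c, by ring⟩

lemma dl_lt (p : ℕ) [hp : Fact p.Prime] (a : ℤ_[p]) : dl p a < p := by
  simpa [dl] using PadicInt.appr_lt (-a) 1

lemma sign_aux (p : ℕ) [hp : Fact p.Prime] (a a' : ℤ_[p]) (ha' : IsDworkPrime p a a') (M : ℕ)
    (hM : (p : ℤ_[p]) ∣ a' - M) :
    ((-1 : ℤ_[p])) ^ (dl p a) * (-1) ^ (M * (p - 1)) = (-1) ^ (de p a) := by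
  have hl := dl_lt p a
  rcases hp.out.eq_two_or_odd with h2 | hodd
  · subst h2
    have hl' : dl' 2 a < 4 := by
      have := PadicInt.appr_lt (-a) 2
      simpa [dl'] using this
    have h4 := PadicInt.appr_spec 2 (-a)
    rw [Ideal.mem_span_singleton] at h4
    have e : (-a).appr 2 = dl' 2 a := by simp [dl']
    rw [e] at h4
    obtain ⟨t, ht⟩ := hM
    unfold IsDworkPrime at ha'
    have h5 : ((2 : ℕ) : ℤ_[2]) ^ 2 ∣ (((dl 2 a : ℤ) - dl' 2 a - 2 * M : ℤ) : ℤ_[2]) := by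
      have : (((dl 2 a : ℤ) - dl' 2 a - 2 * M : ℤ) : ℤ_[2]) =
          (-a - dl' 2 a) + ((2 : ℕ) : ℤ_[2]) ^ 2 * t := by
        push_cast at *
        linear_combination (-1 : ℤ_[2]) * ha' + 2 * ht
      rw [this]
      exact dvd_add h4 (dvd_mul_right _ _)
    rw [PadicInt.pow_p_dvd_int_iff] at h5
    norm_num at h5
    rw [← pow_add]
    apply neg_one_pow_congr
    rw [Nat.even_iff, Nat.even_iff]
    unfold de
    generalize dl 2 a = x at *
    generalize dl' 2 a = y at *
    interval_cases x <;> interval_cases y <;> omega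
  · have hp2 : p ≠ 2 := by rintro rfl; simp at hodd
    have e : dl' p a = dl p a := by simp [dl', dl, hp2]
    have : de p a = dl p a := by
      unfold de
      rw [e, Nat.div_eq_of_lt hl, Nat.sub_zero]
    rw [this, Even.neg_one_pow (n := M * (p - 1)), mul_one]
    apply Even.mul_left
    rw [Nat.even_iff]
    omega

lemma TT_dvd (p : ℕ) [hp : Fact p.Prime] (a a' : ℤ_[p]) (ha' : IsDworkPrime p a a') (n : ℕ)
    (hn : n ≠ 0) (h1 : (p : ℤ_[p]) * a' ≠ 0)
    (h2 : (p : ℤ_[p]) * a' + ((p * n : ℕ) : ℤ_[p]) ≠ 0) :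
    ((p * n : ℕ) : ℤ_[p]) * (((p : ℤ_[p]) * a') * ((p : ℤ_[p]) * a' + ((p * n : ℕ) : ℤ_[p])))
      ∣ TT p (dl p a) n ((-1) ^ (de p a)) ((p : ℤ_[p]) * a') := by
  set w : ℤ_[p] := ((p * n : ℕ) : ℤ_[p]) with hw
  set z : ℤ_[p] := (p : ℤ_[p]) * a' with hz
  have hw0 : w ≠ 0 := by
    rw [hw]
    exact_mod_cast Nat.mul_ne_zero hp.out.ne_zero hn
  have hne : w * (z * (z + w)) ≠ 0 := mul_ne_zero hw0 (mul_ne_zero h1 h2)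
  set c := w * (z * (z + w)) with hc
  -- a power of p divisible by c
  obtain ⟨R, hR⟩ : ∃ R : ℕ, c ∣ (p : ℤ_[p]) ^ R := by
    refine ⟨c.valuation, ?_⟩
    refine ⟨(((PadicInt.unitCoeff hne)⁻¹ : ℤ_[p]ˣ) : ℤ_[p]), ?_⟩
    have h := PadicInt.unitCoeff_spec hne
    generalize PadicInt.unitCoeff hne = u at *
    rw [← Units.inv_mul_eq_iff_eq_mul] at h
    rw [← h, mul_comm]
  set M := a'.appr (R + 1) with hM
  have hspec : (p : ℤ_[p]) ^ (R + 1) ∣ a' - M := by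
    have := PadicInt.appr_spec (R + 1) a'
    rwa [Ideal.mem_span_singleton] at this
  have hpM : (p : ℤ_[p]) ∣ a' - M := (dvd_pow_self _ (by omega)).trans hspec
  set y : ℤ_[p] := ((p * M : ℕ) : ℤ_[p]) with hy
  have hzy : c ∣ z - y := by
    refine hR.trans ((pow_dvd_pow _ (Nat.le_succ R)).trans (hspec.trans ?_))
    refine ⟨(p : ℤ_[p]), ?_⟩
    rw [hz, hy]
    push_cast
    ring
  have hT := TT_nat p (dl p a) n M _ (sign_aux p a a' ha' M hpM)
  rw [← hy, ← hw] at hT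
  have hcong := TT_congr p (dl p a) n ((-1) ^ (de p a)) z y
  have h3 : c ∣ w * (y * (y + w)) := by
    have : w * (y * (y + w)) = c - (z - y) * (w * (z + y + w)) := by
      rw [hc]; ring
    rw [this]
    exact dvd_sub dvd_rfl (hzy.mul_right _)
  have := dvd_add (h3.trans hT) (hzy.trans hcong)
  simpa using this

lemma coe_ne {p : ℕ} [hp : Fact p.Prime] {x : ℤ_[p]} (h : x ≠ 0) : (x : ℚ_[p]) ≠ 0 := by
  intro h0
  exact h (Subtype.ext h0)

end Helpers

/-- (`s = 1`, `c = 1`) if `k = l + b p^m` with `p ∤ b`, then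
`B_k/A_k ≡ B_l/A_l mod p^m ℤ_p`. -/
theorem statement11 (p : ℕ) [Fact p.Prime]
    (a a' : ℤ_[p]) (ha : NotNonposInt p a) (ha' : IsDworkPrime p a a')
    (k b m : ℕ) (hb1 : 1 ≤ b) (hbp : ¬ p ∣ b) (hm : 1 ≤ m)
    (hk : k = dl p a + b * p ^ m) :
    let Aq : ℕ → ℚ_[p] := fun k =>
      (ascPochhammer ℚ_[p] k).eval (a : ℚ_[p]) / (k.factorial : ℚ_[p])
    let A1q : ℕ → ℚ_[p] := fun k =>
      (ascPochhammer ℚ_[p] k).eval (a' : ℚ_[p]) / (k.factorial : ℚ_[p])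
    let Bq : ℕ → ℚ_[p] := fun k =>
      ((k : ℚ_[p]) + (a : ℚ_[p]))⁻¹ *
        (Aq k - (-1 : ℚ_[p]) ^ (de p a) *
          (if dl p a ≤ k ∧ p ∣ (k - dl p a) then A1q ((k - dl p a) / p) else 0))
    ‖Bq k / Aq k - Bq (dl p a) / Aq (dl p a)‖ ≤ (p : ℝ) ^ (-(m : ℤ)) := by
  have hp : p.Prime := Fact.out
  intro Aq A1q Bq
  set l := dl p a with hl
  obtain ⟨n, hn, hnm⟩ : ∃ n, k = l + p * n ∧ p * n = b * p ^ m := by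
    obtain ⟨m', rfl⟩ : ∃ m', m = m' + 1 := ⟨m - 1, by omega⟩
    refine ⟨b * p ^ m', ?_, ?_⟩
    · rw [hk]; ring
    · ring
  have hn0 : n ≠ 0 := by
    rintro rfl
    rw [mul_zero] at hnm
    have := Nat.mul_pos hb1 (pow_pos hp.pos m)
    omega
  have hA' : (p : ℤ_[p]) * a' = a + (l : ℤ_[p]) := ha'
  have hz1 : (p : ℤ_[p]) * a' ≠ 0 := by rw [hA']; exact ha l
  have hz2 : (p : ℤ_[p]) * a' + ((p * n : ℕ) : ℤ_[p]) ≠ 0 := by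
    have := ha (l + p * n)
    rw [hA']
    push_cast at this ⊢
    rwa [add_assoc]
  have hdvd := TT_dvd p a a' ha' n hn0 hz1 hz2
  rw [← hl] at hdvd
  have hpoch : ∀ (x : ℤ_[p]) (j : ℕ), (ascPochhammer ℚ_[p] j).eval (x : ℚ_[p]) =
      (((ascPochhammer ℤ_[p] j).eval x : ℤ_[p]) : ℚ_[p]) := by
    intro x j
    rw [poch_prod, poch_prod]
    have := map_prod (PadicInt.Coe.ringHom (p := p)) (fun i : ℕ => x + (i : ℤ_[p]))
      (Finset.range j)
    refine Eq.trans ?_ this.symm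
    apply Finset.prod_congr rfl
    intro i _
    rw [map_add, map_natCast]
    rfl
  have hpoch0 : ∀ j : ℕ, (ascPochhammer ℤ_[p] j).eval a ≠ 0 := by
    intro j
    rw [poch_prod, Finset.prod_ne_zero_iff]
    intro i _
    exact ha i
  have hlp : l < p := dl_lt p a
  have uL : IsUnit ((-1) ^ l * EE l (-((p : ℤ_[p]) * a'))) :=
    (isUnit_one.neg.pow _).mul (unit_EE p _ (dvd_neg.mpr (dvd_mul_right _ _)) l hlp)
  have uQ : ∀ j, IsUnit (QQ p ((p : ℤ_[p]) * a') j) := unit_QQ p _ (dvd_mul_right _ _)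
  -- the ratio formula
  have ratio : ∀ j : ℕ, Bq (l + p * j) / Aq (l + p * j) =
      (((((p : ℤ_[p]) * a' + ((p * j : ℕ) : ℤ_[p]) : ℤ_[p]) : ℚ_[p]))⁻¹) *
      (1 - (((-1) ^ (de p a) * (EE l ((p * j : ℕ) : ℤ_[p]) * QQ p 0 j) : ℤ_[p]) : ℚ_[p]) /
        (((-1) ^ l * EE l (-((p : ℤ_[p]) * a')) * QQ p ((p : ℤ_[p]) * a') j : ℤ_[p]) : ℚ_[p])) := by
    intro j
    have e1 := poch_split p hp.one_le a a' l j hA'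
    have e2 := fact_split p hp.one_le (R := ℤ_[p]) l j
    have e0 := hpoch0 (l + p * j)
    have f0 : ((l + p * j).factorial : ℤ_[p]) ≠ 0 := by
      exact_mod_cast Nat.factorial_ne_zero _
    have e3 : (((l + p * j : ℕ) : ℚ_[p]) + (a : ℚ_[p])) =
        (((p : ℤ_[p]) * a' + ((p * j : ℕ) : ℤ_[p]) : ℤ_[p]) : ℚ_[p]) := by
      rw [hA']
      push_cast
      ring
    have hcond : l ≤ l + p * j ∧ p ∣ (l + p * j - l) := by
      refine ⟨by omega, ?_⟩
      rw [Nat.add_sub_cancel_left]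
      exact dvd_mul_right _ _
    have hdiv : (l + p * j - l) / p = j := by
      rw [Nat.add_sub_cancel_left, Nat.mul_div_cancel_left _ hp.pos]
    have hAq : Aq (l + p * j) = (((ascPochhammer ℤ_[p] (l + p * j)).eval a : ℤ_[p]) : ℚ_[p]) /
        (((l + p * j).factorial : ℤ_[p]) : ℚ_[p]) := by
      simp only [Aq]
      rw [hpoch]
      norm_cast
    have hA1q : A1q j = (((ascPochhammer ℤ_[p] j).eval a' : ℤ_[p]) : ℚ_[p]) /
        ((j.factorial : ℤ_[p]) : ℚ_[p]) := by
      simp only [A1q]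
      rw [hpoch]
      norm_cast
    have hBq : Bq (l + p * j) = (((p : ℤ_[p]) * a' + ((p * j : ℕ) : ℤ_[p]) : ℤ_[p]) : ℚ_[p])⁻¹ *
        (Aq (l + p * j) - (-1) ^ (de p a) * A1q j) := by
      simp only [Bq]
      rw [if_pos hcond, hdiv, e3]
    rw [e1] at e0 hAq
    rw [e2] at f0 hAq
    have g1 := right_ne_zero_of_mul e0
    have g2 := right_ne_zero_of_mul (left_ne_zero_of_mul e0)
    have g3 := right_ne_zero_of_mul (left_ne_zero_of_mul (left_ne_zero_of_mul e0))
    have g4 := left_ne_zero_of_mul (left_ne_zero_of_mul (left_ne_zero_of_mul e0))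
    have g5 := right_ne_zero_of_mul f0
    have g6 := right_ne_zero_of_mul (left_ne_zero_of_mul (left_ne_zero_of_mul f0))
    have g7 := left_ne_zero_of_mul (left_ne_zero_of_mul (left_ne_zero_of_mul f0))
    rw [hBq, mul_div_assoc]
    congr 1
    rw [hAq, hA1q]
    clear_value Aq A1q Bq
    clear hAq hA1q hBq e1 e2 e3 e0 f0
    generalize (ascPochhammer ℤ_[p] j).eval a' = x1 at *
    generalize (p : ℤ_[p]) ^ j = x2 at *
    generalize QQ p ((p : ℤ_[p]) * a') j = x3 at *
    generalize (-1) ^ l * EE l (-((p : ℤ_[p]) * a')) = x4 at *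
    generalize (j.factorial : ℤ_[p]) = x5 at *
    generalize QQ p (0 : ℤ_[p]) j = x6 at *
    generalize EE l ((p * j : ℕ) : ℤ_[p]) = x7 at *
    have c1 : (x1 : ℚ_[p]) ≠ 0 :=coe_ne g1
    have c2 : (x2 : ℚ_[p]) ≠ 0 :=coe_ne g2
    have c3 : (x3 : ℚ_[p]) ≠ 0 :=coe_ne g3
    have c4 : (x4 : ℚ_[p]) ≠ 0 :=coe_ne g4
    have c5 : (x5 : ℚ_[p]) ≠ 0 :=coe_ne g5
    have c6 : (x6 : ℚ_[p]) ≠ 0 :=coe_ne g6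
    have c7 : (x7 : ℚ_[p]) ≠ 0 :=coe_ne g7
    push_cast
    field_simp
  have r1 := ratio n
  have r0 := ratio 0
  have hq0 : ∀ x : ℤ_[p], QQ p x 0 = 1 := by intro x; simp [QQ]
  simp only [hq0, mul_zero, add_zero, Nat.cast_zero, mul_one] at r0
  rw [hn, r1, r0]
  obtain ⟨t, ht⟩ := hdvd
  have uD := uL.mul (uQ n)
  have hwm : ((p * n : ℕ) : ℤ_[p]) = (b : ℤ_[p]) * (p : ℤ_[p]) ^ m := by
    rw [hnm]; push_cast; ring
  obtain ⟨v, hv⟩ : ∃ v : ℤ_[p], v * (((-1) ^ l * EE l (-((p : ℤ_[p]) * a')) *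
      QQ p ((p : ℤ_[p]) * a') n) * ((-1) ^ l * EE l (-((p : ℤ_[p]) * a')))) = 1 :=
    (uD.mul uL).exists_left_inv
  have d1 := uL.ne_zero
  have d2 := (uQ n).ne_zero
  unfold TT at ht
  have final : ∀ (z w L Q E E0 s t v W : ℤ_[p]), z ≠ 0 → z + w ≠ 0 → L ≠ 0 → Q ≠ 0 →
      (L * Q - s * W) * z * L - (L - s * E0) * (z + w) * (L * Q) = w * (z * (z + w)) * t →
      v * (L * Q * L) = 1 →
      (((z + w : ℤ_[p]) : ℚ_[p]))⁻¹ * (1 - ((s * W : ℤ_[p]) : ℚ_[p]) / ((L * Q : ℤ_[p]) : ℚ_[p])) -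
        ((z : ℚ_[p]))⁻¹ * (1 - ((s * E0 : ℤ_[p]) : ℚ_[p]) / (L : ℚ_[p])) =
        ((w * t * v : ℤ_[p]) : ℚ_[p]) := by
    intro z w L Q E E0 s t v W hz hzw hL hQ h hv
    have c1 : (z : ℚ_[p]) ≠ 0 :=coe_ne hz
    have c2 : (z : ℚ_[p]) + (w : ℚ_[p]) ≠ 0 :=by rw [← PadicInt.coe_add]; exact coe_ne hzw
    have c3 : (L : ℚ_[p]) ≠ 0 :=coe_ne hL
    have c4 : (Q : ℚ_[p]) ≠ 0 :=coe_ne hQ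
    have h' : ((L : ℚ_[p]) * Q - s * W) * z * L - (L - s * E0) * (z + w) * (L * Q) =
        w * (z * (z + w)) * t := by
      have := congrArg (fun x : ℤ_[p] => (x : ℚ_[p])) h
      push_cast at this
      exact this
    have hv' : (v : ℚ_[p]) * (L * Q * L) = 1 := by
      have := congrArg (fun x : ℤ_[p] => (x : ℚ_[p])) hv
      push_cast at this
      exact this
    have hv2 : (v : ℚ_[p]) = 1 / (L * Q * L) := by
      rw [eq_div_iff (mul_ne_zero (mul_ne_zero c3 c4) c3)]; exact hv'
    push_cast
    rw [hv2]
    field_simp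
    linear_combination h'
  rw [final _ _ _ _ 0 _ _ t v _ hz1 hz2 d1 d2 ht hv, ← PadicInt.norm_def,
    PadicInt.norm_le_pow_iff_mem_span_pow, Ideal.mem_span_singleton, hwm]
  exact ⟨b * t * v, by ring⟩

end HGP
end
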